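/- Let a > 0, l ∈ ℕ₀, n ∈ ℕ, and let f : ℝⁿ → ℂ be C^l with f(x) = O(|x|^{-a}). Let α ∈ ℂ with 1 ≤ Re α < min(a, n). Then for every ε with 0 < ε < 1 and every x ∈ ℝⁿ, I^α f is C^{l+⌊Re α⌋-1} on a neighborhood of x with every (l+⌊Re α⌋-1)-th order partial derivative Hölder continuous of index ε on that neighborhood, where ⌊Re α⌋ is the integer part of Re α. -/

import Mathlib

open Complex MeasureTheory Filter Asymptotics Set Metric

/-- `H_n(α) = 2^α π^(n/2) Γ(α/2) / Γ((n-α)/2)`. -/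
noncomputable def Hfun (n : ℕ) (α : ℂ) : ℂ :=
  (2 : ℂ) ^ α * (Real.pi : ℂ) ^ ((n : ℂ) / 2) * Complex.Gamma (α / 2) /
    Complex.Gamma (((n : ℂ) - α) / 2)

/-- The Riesz potential `(I^α f)(x) = (1/H_n(α)) ∫_{ℝⁿ} f(y) |x-y|^{α-n} dy`. -/
noncomputable def riesz (n : ℕ) (f : EuclideanSpace ℝ (Fin n) → ℂ) (α : ℂ)
    (x : EuclideanSpace ℝ (Fin n)) : ℂ :=
  (Hfun n α)⁻¹ * ∫ y : EuclideanSpace ℝ (Fin n), f y * (‖x - y‖ : ℂ) ^ (α - n)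

/-- `K` is smooth away from the origin, and its `j`-th derivative is `O(‖z‖ ^ (γ - j))`. -/
structure IsSingularKernel {E F : Type*} [NormedAddCommGroup E] [NormedSpace ℝ E]
    [NormedAddCommGroup F] [NormedSpace ℝ F] (K : E → F) (γ : ℝ) : Prop where
  contDiffAt : ∀ j : ℕ, ∀ z ≠ 0, ContDiffAt ℝ j K z
  bound : ∀ j : ℕ, ∃ C, ∀ z ≠ 0, ‖iteratedFDeriv ℝ j K z‖ ≤ C * ‖z‖ ^ (γ - j)

lemma half_norm_le_of_norm_sub_le {E : Type*} [SeminormedAddCommGroup E] {z w : E}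
    (h : ‖w - z‖ ≤ ‖z‖ / 2) : ‖z‖ / 2 ≤ ‖w‖ := by
  have := norm_sub_norm_le z w
  rw [norm_sub_rev] at this
  linarith

/-- If `r ≤ 3 s`, then `r ^ γ` is controlled by `s ^ θ * r ^ (γ - θ)`. -/
lemma rpow_le_mul_rpow_of_le_three_mul {r s γ θ : ℝ} (hr : 0 < r) (h : r ≤ 3 * s) (hθ : 0 ≤ θ) :
    r ^ γ ≤ 3 ^ θ * (s ^ θ * r ^ (γ - θ)) := by
  have hs : 0 ≤ s := by linarith
  calc r ^ γ = r ^ θ * r ^ (γ - θ) := by rw [← Real.rpow_add hr]; ring_nf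
    _ ≤ (3 * s) ^ θ * r ^ (γ - θ) := by gcongr
    _ = _ := by rw [Real.mul_rpow (by norm_num) hs]; ring

/-- If `s ≤ r`, powers of `s` can be traded for powers of `r`. -/
lemma rpow_mul_rpow_le_of_le {r s γ θ p : ℝ} (hr : 0 < r) (hs : 0 < s) (h : s ≤ r) (hθ : θ ≤ p) :
    r ^ (γ - p) * s ^ p ≤ s ^ θ * r ^ (γ - θ) := by
  calc r ^ (γ - p) * s ^ p = r ^ (γ - p) * (s ^ θ * s ^ (p - θ)) := by
        rw [← Real.rpow_add hs]; ring_nf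
    _ ≤ r ^ (γ - p) * (s ^ θ * r ^ (p - θ)) := by
        gcongr
    _ = s ^ θ * (r ^ (γ - p) * r ^ (p - θ)) := by ring
    _ = _ := by rw [← Real.rpow_add hr]; ring_nf

namespace IsSingularKernel

section Pointwise

variable {E F : Type*} [NormedAddCommGroup E] [NormedSpace ℝ E]
  [NormedAddCommGroup F] [NormedSpace ℝ F] {K : E → F} {γ : ℝ}

protected lemma fderiv (hK : IsSingularKernel K γ) : IsSingularKernel (fderiv ℝ K) (γ - 1) where
  contDiffAt j z hz := (hK.contDiffAt (j + 1) z hz).fderiv_right (by norm_cast)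
  bound j := by
    obtain ⟨C, hC⟩ := hK.bound (j + 1)
    refine ⟨C, fun z hz => ?_⟩
    rw [norm_iteratedFDeriv_fderiv]
    convert hC z hz using 3
    push_cast
    ring

lemma exists_norm_le (hK : IsSingularKernel K γ) :
    ∃ C, 0 ≤ C ∧ ∀ z ≠ 0, ‖K z‖ ≤ C * ‖z‖ ^ γ := by
  obtain ⟨C, hC⟩ := hK.bound 0
  refine ⟨|C|, abs_nonneg _, fun z hz => ?_⟩
  have := hC z hz
  simp only [norm_iteratedFDeriv_zero, CharP.cast_eq_zero, sub_zero] at this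
  exact this.trans (by gcongr; exact le_abs_self C)

lemma differentiableAt (hK : IsSingularKernel K γ) {z : E} (hz : z ≠ 0) :
    DifferentiableAt ℝ K z :=
  (hK.contDiffAt 1 z hz).differentiableAt (by norm_num)

/-- Lipschitz estimate for nearby points. -/
lemma exists_norm_sub_le_of_near (hK : IsSingularKernel K γ) (hγ : γ ≤ 1) :
    ∃ C, 0 ≤ C ∧ ∀ z ≠ 0, ∀ w, ‖w - z‖ ≤ ‖z‖ / 2 →
      ‖K w - K z‖ ≤ C * ‖z‖ ^ (γ - 1) * ‖w - z‖ := by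
  obtain ⟨C, hC0, hC⟩ := hK.fderiv.exists_norm_le
  refine ⟨C * (1 / 2) ^ (γ - 1), by positivity, fun z hz w hw => ?_⟩
  have hz' : 0 < ‖z‖ := norm_pos_iff.mpr hz
  have hne : ∀ v ∈ closedBall z (‖z‖ / 2), v ≠ 0 ∧ ‖z‖ / 2 ≤ ‖v‖ := fun v hv => by
    have := half_norm_le_of_norm_sub_le (mem_closedBall_iff_norm.mp hv)
    exact ⟨norm_pos_iff.mp (by linarith), this⟩
  refine (convex_closedBall z (‖z‖ / 2)).norm_image_sub_le_of_norm_fderiv_le (𝕜 := ℝ)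
    (fun v hv => hK.differentiableAt (hne v hv).1) (fun v hv => (hC v (hne v hv).1).trans ?_)
    (mem_closedBall_self (by positivity)) (mem_closedBall_iff_norm.mpr hw)
  rw [mul_assoc, ← Real.mul_rpow (by norm_num) hz'.le]
  gcongr C * ?_
  refine Real.rpow_le_rpow_of_nonpos (by positivity) ?_ (by linarith)
  linarith [(hne v hv).2]

/-- Global Hölder-type estimate for a singular kernel. -/
lemma exists_norm_sub_le (hK : IsSingularKernel K γ) (hγ : γ ≤ 1) {θ : ℝ} (hθ0 : 0 ≤ θ)
    (hθ1 : θ ≤ 1) :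
    ∃ C, 0 ≤ C ∧ ∀ z ≠ 0, ∀ w ≠ 0,
      ‖K w - K z‖ ≤ C * ‖w - z‖ ^ θ * (‖z‖ ^ (γ - θ) + ‖w‖ ^ (γ - θ)) := by
  obtain ⟨C₀, hC₀, hb⟩ := hK.exists_norm_le
  obtain ⟨C₁, hC₁, hn⟩ := hK.exists_norm_sub_le_of_near hγ
  refine ⟨C₁ + C₀ * 3 ^ θ, by positivity, fun z hz w hw => ?_⟩
  have hz' : 0 < ‖z‖ := norm_pos_iff.mpr hz
  have hw' : 0 < ‖w‖ := norm_pos_iff.mpr hw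
  rcases eq_or_ne w z with rfl | hne
  · simp only [sub_self, norm_zero]; positivity
  have hs : 0 < ‖w - z‖ := norm_pos_iff.mpr (sub_ne_zero.mpr hne)
  rcases le_total ‖w - z‖ (‖z‖ / 2) with h | h
  · have h1 := rpow_mul_rpow_le_of_le (γ := γ) (p := 1) hz' hs (by linarith) hθ1
    rw [Real.rpow_one] at h1
    calc ‖K w - K z‖ ≤ C₁ * (‖z‖ ^ (γ - 1) * ‖w - z‖) := by rw [← mul_assoc]; exact hn z hz w h
      _ ≤ C₁ * (‖w - z‖ ^ θ * ‖z‖ ^ (γ - θ)) := by gcongr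
      _ ≤ (C₁ + C₀ * 3 ^ θ) * (‖w - z‖ ^ θ * (‖z‖ ^ (γ - θ) + ‖w‖ ^ (γ - θ))) := by
        gcongr
        · exact le_add_of_nonneg_right (by positivity)
        · exact le_add_of_nonneg_right (by positivity)
      _ = _ := by ring
  · have hw3 : ‖w‖ ≤ 3 * ‖w - z‖ := by
      have := norm_sub_norm_le w z
      linarith
    calc ‖K w - K z‖ ≤ C₀ * ‖w‖ ^ γ + C₀ * ‖z‖ ^ γ :=
        (norm_sub_le _ _).trans (add_le_add (hb w hw) (hb z hz))
      _ ≤ C₀ * (3 ^ θ * (‖w - z‖ ^ θ * ‖w‖ ^ (γ - θ)))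
          + C₀ * (3 ^ θ * (‖w - z‖ ^ θ * ‖z‖ ^ (γ - θ))) := by
        gcongr
        · exact rpow_le_mul_rpow_of_le_three_mul hw' hw3 hθ0
        · exact rpow_le_mul_rpow_of_le_three_mul hz' (by linarith) hθ0
      _ = (C₀ * 3 ^ θ) * (‖w - z‖ ^ θ * (‖z‖ ^ (γ - θ) + ‖w‖ ^ (γ - θ))) := by ring
      _ ≤ (C₁ + C₀ * 3 ^ θ) * (‖w - z‖ ^ θ * (‖z‖ ^ (γ - θ) + ‖w‖ ^ (γ - θ))) := by
        exact mul_le_mul_of_nonneg_right (le_add_of_nonneg_left hC₁) (by positivity)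
      _ = _ := by ring

/-- Global first-order Taylor estimate for a singular kernel. -/
lemma exists_norm_sub_sub_le (hK : IsSingularKernel K γ) (hγ : γ ≤ 2) {θ : ℝ} (hθ1 : 1 ≤ θ)
    (hθ2 : θ ≤ 2) :
    ∃ C, 0 ≤ C ∧ ∀ z ≠ 0, ∀ w ≠ 0,
      ‖K w - K z - fderiv ℝ K z (w - z)‖ ≤
        C * ‖w - z‖ ^ θ * (‖z‖ ^ (γ - θ) + ‖w‖ ^ (γ - θ)) := by
  obtain ⟨C₀, hC₀, hb⟩ := hK.exists_norm_le
  obtain ⟨D₀, hD₀, hDb⟩ := hK.fderiv.exists_norm_le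
  obtain ⟨C₁, hC₁, hn⟩ := hK.fderiv.exists_norm_sub_le_of_near (by linarith)
  refine ⟨C₁ + (C₀ * 3 ^ θ + D₀ * 3 ^ (θ - 1)), by positivity, fun z hz w hw => ?_⟩
  have hz' : 0 < ‖z‖ := norm_pos_iff.mpr hz
  have hw' : 0 < ‖w‖ := norm_pos_iff.mpr hw
  rcases eq_or_ne w z with rfl | hne
  · simp only [sub_self, norm_zero, map_zero]; positivity
  have hs : 0 < ‖w - z‖ := norm_pos_iff.mpr (sub_ne_zero.mpr hne)
  rcases le_total ‖w - z‖ (‖z‖ / 2) with h | h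
  · have h1 := rpow_mul_rpow_le_of_le (γ := γ) (p := 2) hz' hs (by linarith) hθ2
    have hball : ∀ v ∈ closedBall z ‖w - z‖, ‖v - z‖ ≤ ‖z‖ / 2 ∧ v ≠ 0 := fun v hv => by
      have hv' : ‖v - z‖ ≤ ‖z‖ / 2 := (mem_closedBall_iff_norm.mp hv).trans h
      exact ⟨hv', norm_pos_iff.mp (by linarith [half_norm_le_of_norm_sub_le hv'])⟩
    have key := (convex_closedBall z ‖w - z‖).norm_image_sub_le_of_norm_fderiv_le' (𝕜 := ℝ)
      (f := K) (φ := fderiv ℝ K z) (C := C₁ * ‖z‖ ^ (γ - 1 - 1) * ‖w - z‖)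
      (x := z) (y := w)
      (fun v hv => hK.differentiableAt (hball v hv).2)
      (fun v hv => (hn z hz v (hball v hv).1).trans (by
        gcongr
        exact mem_closedBall_iff_norm.mp hv))
      (mem_closedBall_self (by positivity)) (mem_closedBall_iff_norm.mpr le_rfl)
    calc _ ≤ C₁ * ‖z‖ ^ (γ - 1 - 1) * ‖w - z‖ * ‖w - z‖ := key
      _ = C₁ * (‖z‖ ^ (γ - 2) * ‖w - z‖ ^ (2 : ℝ)) := by
        rw [show γ - 1 - 1 = γ - 2 by ring, Real.rpow_two]; ring
      _ ≤ C₁ * (‖w - z‖ ^ θ * ‖z‖ ^ (γ - θ)) := by gcongr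
      _ ≤ (C₁ + (C₀ * 3 ^ θ + D₀ * 3 ^ (θ - 1))) *
          (‖w - z‖ ^ θ * (‖z‖ ^ (γ - θ) + ‖w‖ ^ (γ - θ))) := by
        gcongr
        · exact le_add_of_nonneg_right (by positivity)
        · exact le_add_of_nonneg_right (by positivity)
      _ = _ := by ring
  · have hw3 : ‖w‖ ≤ 3 * ‖w - z‖ := by
      have := norm_sub_norm_le w z
      linarith
    have hD := rpow_le_mul_rpow_of_le_three_mul (γ := γ - 1) (θ := θ - 1) hz'
      (show ‖z‖ ≤ 3 * ‖w - z‖ by linarith) (by linarith)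
    rw [show γ - 1 - (θ - 1) = γ - θ by ring] at hD
    have hsθ : ‖w - z‖ ^ (θ - 1) * ‖w - z‖ = ‖w - z‖ ^ θ := by
      rw [← Real.rpow_add_one hs.ne']; ring_nf
    calc _ ≤ ‖K w‖ + ‖K z‖ + ‖fderiv ℝ K z‖ * ‖w - z‖ :=
        (norm_sub_le _ _).trans (add_le_add (norm_sub_le _ _)
          (ContinuousLinearMap.le_opNorm _ _))
      _ ≤ C₀ * ‖w‖ ^ γ + C₀ * ‖z‖ ^ γ + D₀ * ‖z‖ ^ (γ - 1) * ‖w - z‖ := by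
        gcongr
        · exact hb w hw
        · exact hb z hz
        · exact hDb z hz
      _ ≤ C₀ * (3 ^ θ * (‖w - z‖ ^ θ * ‖w‖ ^ (γ - θ)))
          + C₀ * (3 ^ θ * (‖w - z‖ ^ θ * ‖z‖ ^ (γ - θ)))
          + D₀ * (3 ^ (θ - 1) * (‖w - z‖ ^ (θ - 1) * ‖z‖ ^ (γ - θ))) * ‖w - z‖ := by
        gcongr
        · exact rpow_le_mul_rpow_of_le_three_mul hw' hw3 (by linarith)
        · exact rpow_le_mul_rpow_of_le_three_mul hz' (by linarith) (by linarith)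
      _ = (C₀ * 3 ^ θ) * (‖w - z‖ ^ θ * (‖z‖ ^ (γ - θ) + ‖w‖ ^ (γ - θ)))
          + D₀ * 3 ^ (θ - 1) * ((‖w - z‖ ^ (θ - 1) * ‖w - z‖) * ‖z‖ ^ (γ - θ)) := by ring
      _ = (C₀ * 3 ^ θ) * (‖w - z‖ ^ θ * (‖z‖ ^ (γ - θ) + ‖w‖ ^ (γ - θ)))
          + D₀ * 3 ^ (θ - 1) * (‖w - z‖ ^ θ * ‖z‖ ^ (γ - θ)) := by rw [hsθ]
      _ ≤ (C₀ * 3 ^ θ) * (‖w - z‖ ^ θ * (‖z‖ ^ (γ - θ) + ‖w‖ ^ (γ - θ)))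
          + D₀ * 3 ^ (θ - 1) * (‖w - z‖ ^ θ * (‖z‖ ^ (γ - θ) + ‖w‖ ^ (γ - θ))) := by
        gcongr
        exact le_add_of_nonneg_right (by positivity)
      _ = (C₀ * 3 ^ θ + D₀ * 3 ^ (θ - 1)) *
          (‖w - z‖ ^ θ * (‖z‖ ^ (γ - θ) + ‖w‖ ^ (γ - θ))) := by ring
      _ ≤ (C₁ + (C₀ * 3 ^ θ + D₀ * 3 ^ (θ - 1))) *
          (‖w - z‖ ^ θ * (‖z‖ ^ (γ - θ) + ‖w‖ ^ (γ - θ))) := by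
        exact mul_le_mul_of_nonneg_right (le_add_of_nonneg_left hC₁) (by positivity)
      _ = _ := by ring

end Pointwise

end IsSingularKernel

section NormCpow

variable {E : Type*} [NormedAddCommGroup E] [InnerProductSpace ℝ E]

lemma contDiffAt_norm_cpow (β : ℂ) {z : E} (hz : z ≠ 0) (j : WithTop ℕ∞) :
    ContDiffAt ℝ j (fun z : E => (‖z‖ : ℂ) ^ β) z := by
  have h : ContDiffAt ℝ j (fun z : E => Complex.exp ((Real.log ‖z‖ : ℝ) * β)) z :=
    ((ofRealCLM.contDiff.contDiffAt.comp z
      ((contDiffAt_norm ℝ hz).log (norm_ne_zero_iff.mpr hz))).mul contDiffAt_const).cexp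
  refine h.congr_of_eventuallyEq ?_
  filter_upwards [isOpen_ne.mem_nhds hz] with w hw
  rw [cpow_def_of_ne_zero (by simpa using hw), ofReal_log (norm_nonneg w)]

lemma norm_iteratedFDeriv_norm_cpow_smul (β : ℂ) (j : ℕ) {z : E} (hz : z ≠ 0) {t : ℝ}
    (ht : 0 < t) :
    t ^ j * ‖iteratedFDeriv ℝ j (fun z : E => (‖z‖ : ℂ) ^ β) (t • z)‖ =
      t ^ β.re * ‖iteratedFDeriv ℝ j (fun z : E => (‖z‖ : ℂ) ^ β) z‖ := by
  set k : E → ℂ := fun z => (‖z‖ : ℂ) ^ β with hk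
  have hcomp : k ∘ (ContinuousLinearEquiv.smulLeft (R₁ := ℝ) (Units.mk0 t ht.ne') : E ≃L[ℝ] E) =
      ((t : ℂ) ^ β) • k := by
    ext z
    have : Units.mk0 t ht.ne' • z = t • z := rfl
    simp [hk, this, norm_smul, abs_of_pos ht, mul_cpow_ofReal_nonneg ht.le (norm_nonneg z)]
  have h1 := iteratedFDeriv_const_smul_apply (a := (t : ℂ) ^ β)
    (contDiffAt_norm_cpow β hz (j : WithTop ℕ∞))
  have h2 := (ContinuousLinearEquiv.smulLeft (R₁ := ℝ) (Units.mk0 t ht.ne') :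
    E ≃L[ℝ] E).iteratedFDerivWithin_comp_right k uniqueDiffOn_univ (x := z) (mem_univ _) j
  rw [preimage_univ, iteratedFDerivWithin_univ, iteratedFDerivWithin_univ, hcomp, h1] at h2
  have h3 : ‖(t : ℂ) ^ β • iteratedFDeriv ℝ j k z‖ = t ^ β.re * ‖iteratedFDeriv ℝ j k z‖ := by
    rw [norm_smul, norm_cpow_eq_rpow_re_of_pos ht]
  rw [← h3, h2]
  have h4 : ∀ m : E [×j]→L[ℝ] ℂ, (m.compContinuousLinearMap fun _ =>
      ((ContinuousLinearEquiv.smulLeft (R₁ := ℝ) (Units.mk0 t ht.ne') : E ≃L[ℝ] E) : E →L[ℝ] E))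
        = (t ^ j : ℝ) • m := by
    intro m
    ext v
    have : ∀ z : E, Units.mk0 t ht.ne' • z = t • z := fun _ => rfl
    simp [this, m.map_smul_univ]
  rw [h4, norm_smul, Real.norm_of_nonneg (by positivity)]
  rfl

/-- The Riesz kernel `‖z‖ ^ β` is a singular kernel of order `re β`. -/
lemma isSingularKernel_norm_cpow [FiniteDimensional ℝ E] (β : ℂ) :
    IsSingularKernel (fun z : E => (‖z‖ : ℂ) ^ β) β.re where
  contDiffAt j z hz := contDiffAt_norm_cpow β hz j
  bound j := by
    have hcont : ContinuousOn (iteratedFDeriv ℝ j (fun z : E => (‖z‖ : ℂ) ^ β)) (sphere 0 1) :=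
      fun z hz => ((contDiffAt_norm_cpow β (ne_zero_of_mem_unit_sphere ⟨z, hz⟩)
        (j : WithTop ℕ∞)).iteratedFDeriv_right (m := 0) (i := j) (by simp)).continuousAt
          |>.continuousWithinAt
    obtain ⟨C, hC⟩ := (isCompact_sphere (0 : E) 1).exists_bound_of_continuousOn hcont
    refine ⟨C, fun z hz => ?_⟩
    have hz' : 0 < ‖z‖ := norm_pos_iff.mpr hz
    have hu : ‖z‖⁻¹ • z ∈ sphere (0 : E) 1 := by
      simp [norm_smul, hz'.ne']
    have h := norm_iteratedFDeriv_norm_cpow_smul β j (z := ‖z‖⁻¹ • z)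
      (ne_zero_of_mem_unit_sphere ⟨_, hu⟩) hz'
    rw [smul_inv_smul₀ hz'.ne'] at h
    rw [Real.rpow_sub hz', Real.rpow_natCast, mul_div_assoc', le_div_iff₀ (by positivity),
      mul_comm, h, mul_comm]
    gcongr
    exact hC _ hu

end NormCpow

/-- `u` is of class `C^N` at `x`, and its `N`-th derivative is `ε`-Hölder near `x`. -/
def IsLocallyHolderAt {E F : Type*} [NormedAddCommGroup E] [NormedSpace ℝ E]
    [NormedAddCommGroup F] [NormedSpace ℝ F] (ε : ℝ) (N : ℕ) (u : E → F) (x : E) : Prop :=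
  ContDiffAt ℝ N u x ∧ ∃ V ∈ nhds x, ∃ M, ∀ x₁ ∈ V, ∀ x₂ ∈ V,
    ‖iteratedFDeriv ℝ N u x₁ - iteratedFDeriv ℝ N u x₂‖ ≤ M * ‖x₁ - x₂‖ ^ ε

namespace IsLocallyHolderAt

variable {E F : Type*} [NormedAddCommGroup E] [NormedSpace ℝ E]
  [NormedAddCommGroup F] [NormedSpace ℝ F] {ε : ℝ} {N : ℕ} {u v : E → F} {x : E}

lemma zero_of_continuousOn {V : Set E} (hV : V ∈ nhds x) (hu : ContinuousOn u V) {M : ℝ}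
    (h : ∀ x₁ ∈ V, ∀ x₂ ∈ V, ‖u x₁ - u x₂‖ ≤ M * ‖x₁ - x₂‖ ^ ε) :
    IsLocallyHolderAt ε 0 u x := by
  refine ⟨contDiffAt_zero.mpr ⟨V, hV, hu⟩, V, hV, M, fun x₁ h₁ x₂ h₂ => ?_⟩
  simp only [iteratedFDeriv_zero_eq_comp, Function.comp_apply, ← map_sub,
    LinearIsometryEquiv.norm_map]
  exact h x₁ h₁ x₂ h₂

lemma succ_of_hasFDerivAt {u' : E → E →L[ℝ] F} (hu : ∀ᶠ y in nhds x, HasFDerivAt u (u' y) y)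
    (h : IsLocallyHolderAt ε N u' x) : IsLocallyHolderAt ε (N + 1) u x := by
  obtain ⟨hc, V, hV, M, hM⟩ := h
  refine ⟨?_, ?_⟩
  · push_cast
    exact contDiffAt_succ_iff_hasFDerivAt.mpr ⟨u', ⟨_, hu, fun y hy => hy⟩, hc⟩
  · have heq : fderiv ℝ u =ᶠ[nhds x] u' := hu.mono fun y hy => hy.fderiv
    refine ⟨_, inter_mem hV (heq.iteratedFDeriv ℝ N), M, fun x₁ h₁ x₂ h₂ => ?_⟩
    rw [iteratedFDeriv_succ_eq_comp_right, iteratedFDeriv_succ_eq_comp_right]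
    have e₁ : iteratedFDeriv ℝ N (fun y => fderiv ℝ u y) x₁ = _ := h₁.2
    have e₂ : iteratedFDeriv ℝ N (fun y => fderiv ℝ u y) x₂ = _ := h₂.2
    rw [Function.comp_apply, Function.comp_apply, e₁, e₂, ← LinearIsometryEquiv.map_sub,
      LinearIsometryEquiv.norm_map]
    exact hM x₁ h₁.1 x₂ h₂.1

lemma of_contDiffAt (hε1 : ε ≤ 1) (h : ContDiffAt ℝ (N + 1 : ℕ) u x) :
    IsLocallyHolderAt ε N u x := by
  refine ⟨h.of_le (by norm_cast; omega), ?_⟩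
  obtain ⟨K, t, ht, hK⟩ := (h.iteratedFDeriv_right (m := 1) (i := N)
    (by norm_cast; omega)).exists_lipschitzOnWith
  refine ⟨_, inter_mem ht (ball_mem_nhds x (by norm_num : (0 : ℝ) < 1 / 2)), K,
    fun x₁ h₁ x₂ h₂ => ?_⟩
  rw [← dist_eq_norm, ← dist_eq_norm]
  have hd : dist x₁ x₂ ≤ 1 := by
    linarith [dist_triangle_right x₁ x₂ x, mem_ball.mp h₁.2, mem_ball.mp h₂.2]
  refine (hK.dist_le_mul x₁ h₁.1 x₂ h₂.1).trans ?_
  gcongr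
  exact Real.self_le_rpow_of_le_one dist_nonneg hd hε1

lemma add (hu : IsLocallyHolderAt ε N u x) (hv : IsLocallyHolderAt ε N v x) :
    IsLocallyHolderAt ε N (u + v) x := by
  obtain ⟨hcu, U, hU, M, hM⟩ := hu
  obtain ⟨hcv, V, hV, M', hM'⟩ := hv
  refine ⟨hcu.add hcv, _, inter_mem (inter_mem hU hV) (inter_mem
    (hcu.eventually (by simp)) (hcv.eventually (by simp))), M + M', fun x₁ h₁ x₂ h₂ => ?_⟩
  rw [iteratedFDeriv_add_apply h₁.2.1 h₁.2.2, iteratedFDeriv_add_apply h₂.2.1 h₂.2.2,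
    add_sub_add_comm, add_mul]
  exact (norm_add_le _ _).trans
    (add_le_add (hM x₁ h₁.1.1 x₂ h₂.1.1) (hM' x₁ h₁.1.2 x₂ h₂.1.2))

lemma congr (hu : IsLocallyHolderAt ε N u x) (h : v =ᶠ[nhds x] u) :
    IsLocallyHolderAt ε N v x := by
  obtain ⟨hcu, U, hU, M, hM⟩ := hu
  refine ⟨hcu.congr_of_eventuallyEq h, _, inter_mem hU (h.iteratedFDeriv ℝ N), M,
    fun x₁ h₁ x₂ h₂ => ?_⟩
  have e₁ : iteratedFDeriv ℝ N v x₁ = _ := h₁.2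
  have e₂ : iteratedFDeriv ℝ N v x₂ = _ := h₂.2
  rw [e₁, e₂]
  exact hM x₁ h₁.1 x₂ h₂.1

lemma exists_isOpen (hu : IsLocallyHolderAt ε N u x) :
    ∃ V : Set E, IsOpen V ∧ x ∈ V ∧ ContDiffOn ℝ N u V ∧ ∃ M : ℝ, ∀ x₁ ∈ V, ∀ x₂ ∈ V,
      ‖iteratedFDerivWithin ℝ N u V x₁ - iteratedFDerivWithin ℝ N u V x₂‖ ≤
        M * ‖x₁ - x₂‖ ^ ε := by
  obtain ⟨hcu, U, hU, M, hM⟩ := hu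
  obtain ⟨V, hVU, hVo, hxV⟩ := _root_.mem_nhds_iff.mp (inter_mem hU (hcu.eventually (by simp)))
  refine ⟨V, hVo, hxV,
    fun y hy => ContDiffAt.contDiffWithinAt (show ContDiffAt ℝ N u y from (hVU hy).2), M,
    fun x₁ h₁ x₂ h₂ => ?_⟩
  rw [iteratedFDerivWithin_of_isOpen N hVo h₁, iteratedFDerivWithin_of_isOpen N hVo h₂]
  exact hM x₁ (hVU h₁).1 x₂ (hVU h₂).1

end IsLocallyHolderAt

section Convolution

variable {E F G H : Type*} [NormedAddCommGroup E] [NormedSpace ℝ E] [FiniteDimensional ℝ E]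
  [MeasurableSpace E] [BorelSpace E] {μ : Measure E} [μ.IsAddHaarMeasure]
  [NormedAddCommGroup F] [NormedSpace ℝ F] [NormedAddCommGroup G]
  [NormedAddCommGroup H] [NormedSpace ℝ H]

lemma locallyIntegrable_norm_rpow [Nontrivial E] {δ : ℝ} (hδ : -(Module.finrank ℝ E : ℝ) < δ) :
    LocallyIntegrable (fun x : E => ‖x‖ ^ δ) μ := by
  intro x
  refine ⟨ball 0 (‖x‖ + 1), isOpen_ball.mem_nhds (by simp), ?_⟩
  set R := ‖x‖ + 1
  have hR : 0 < R := by positivity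
  have hd : 0 < Module.finrank ℝ E := Module.finrank_pos
  have h1 : IntegrableOn (fun y : ℝ => y ^ ((Module.finrank ℝ E : ℝ) - 1 + δ)) (Ioo 0 R) :=
    (intervalIntegral.integrableOn_Ioo_rpow_iff hR).mpr (by linarith)
  have h2 : Integrable (fun z : E => (Iio R).indicator (fun y : ℝ => y ^ δ) ‖z‖) μ := by
    rw [integrable_fun_norm_addHaar]
    have : (fun y : ℝ => y ^ (Module.finrank ℝ E - 1) • (Iio R).indicator (fun y : ℝ => y ^ δ) y)
        = (Iio R).indicator (fun y : ℝ => y ^ (Module.finrank ℝ E - 1) * y ^ δ) := by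
      ext y
      by_cases hy : y ∈ Iio R <;> simp [hy]
    rw [this, integrableOn_indicator_iff measurableSet_Iio, Iio_inter_Ioi]
    refine h1.congr_fun (fun y hy => ?_) measurableSet_Ioo
    simp only
    rw [Real.rpow_add hy.1, ← Real.rpow_natCast, Nat.cast_sub hd, Nat.cast_one]
  refine (h2.integrableOn (s := ball 0 R)).congr_fun (fun z hz => ?_) measurableSet_ball
  have : ‖z‖ ∈ Iio R := by simpa using hz
  simp [this]

namespace IsSingularKernel

variable {K : E → F} {γ : ℝ}

lemma aestronglyMeasurable [Nontrivial E] (hK : IsSingularKernel K γ) :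
    AEStronglyMeasurable K μ := by
  have hc : ContinuousOn K {0}ᶜ := fun z hz =>
    (hK.contDiffAt 0 z hz).continuousAt.continuousWithinAt
  have := hc.aestronglyMeasurable (μ := μ) (measurableSet_singleton (0 : E)).compl
  rwa [restrict_compl_singleton] at this

lemma locallyIntegrable [Nontrivial E] (hK : IsSingularKernel K γ)
    (hγ : -(Module.finrank ℝ E : ℝ) < γ) : LocallyIntegrable K μ := by
  obtain ⟨C, hC0, hC⟩ := hK.exists_norm_le
  refine ((locallyIntegrable_norm_rpow (μ := μ) hγ).smul C).mono hK.aestronglyMeasurable ?_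
  filter_upwards [Measure.ae_ne μ 0] with z hz
  simpa [abs_of_nonneg hC0, abs_of_nonneg (Real.rpow_nonneg (norm_nonneg z) γ)] using hC z hz

end IsSingularKernel

/-- The Riesz-type potential of order `δ` of the norm of `g`. -/
noncomputable def normPotential (μ : Measure E) (δ : ℝ) (g : E → G) (x : E) : ℝ :=
  ∫ y, ‖x - y‖ ^ δ * ‖g y‖ ∂μ

section NormPotential

variable [Nontrivial E] {δ : ℝ} {g : E → G}

lemma integrable_normPotential (hδ : -(Module.finrank ℝ E : ℝ) < δ) (hg : Continuous g)
    (hgc : HasCompactSupport g) (x : E) :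
    Integrable (fun y => ‖x - y‖ ^ δ * ‖g y‖) μ := by
  have h := hgc.norm.convolutionExists_right (ContinuousLinearMap.mul ℝ ℝ)
    (locallyIntegrable_norm_rpow (μ := μ) hδ) hg.norm x
  simpa using h.integrable_swap

lemma continuous_normPotential (hδ : -(Module.finrank ℝ E : ℝ) < δ) (hg : Continuous g)
    (hgc : HasCompactSupport g) : Continuous (normPotential μ δ g) := by
  have h := hgc.norm.continuous_convolution_right (ContinuousLinearMap.mul ℝ ℝ)
    (locallyIntegrable_norm_rpow (μ := μ) hδ) hg.norm
  convert h using 1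
  ext x
  rw [convolution_eq_swap]
  rfl

variable [NormedSpace ℝ G]

lemma norm_integral_le_normPotential (L : F →L[ℝ] G →L[ℝ] H)
    (hδ : -(Module.finrank ℝ E : ℝ) < δ) (hg : Continuous g)
    (hgc : HasCompactSupport g) {A : E → F} {c : ℝ} {x₁ x₂ : E}
    (hA : ∀ y, y ≠ x₁ → y ≠ x₂ → ‖A y‖ ≤ c * (‖x₁ - y‖ ^ δ + ‖x₂ - y‖ ^ δ)) :
    ‖∫ y, L (A y) (g y) ∂μ‖ ≤
      ‖L‖ * (c * (normPotential μ δ g x₁ + normPotential μ δ g x₂)) := by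
  have h₁ := integrable_normPotential (μ := μ) hδ hg hgc x₁
  have h₂ := integrable_normPotential (μ := μ) hδ hg hgc x₂
  have := norm_integral_le_of_norm_le (f := fun y => L (A y) (g y))
    ((h₁.add h₂).const_mul (‖L‖ * c)) (by
      filter_upwards [Measure.ae_ne μ x₁, Measure.ae_ne μ x₂] with y hy₁ hy₂
      calc ‖L (A y) (g y)‖ ≤ ‖L‖ * ‖A y‖ * ‖g y‖ := L.le_opNorm₂ _ _
        _ ≤ ‖L‖ * (c * (‖x₁ - y‖ ^ δ + ‖x₂ - y‖ ^ δ)) * ‖g y‖ := by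
          gcongr
          exact hA y hy₁ hy₂
        _ = _ := by simp only [Pi.add_apply]; ring)
  rw [integral_const_mul, integral_add' h₁ h₂, mul_assoc] at this
  exact this

end NormPotential

namespace IsSingularKernel

open scoped Convolution

variable {K : E → F} {γ : ℝ} [Nontrivial E] [NormedSpace ℝ G] {g : E → G} (L : F →L[ℝ] G →L[ℝ] H)

lemma exists_norm_convolution_sub_le (hK : IsSingularKernel K γ) (hγ : γ ≤ 1) {θ : ℝ}
    (hθ0 : 0 ≤ θ) (hθ1 : θ ≤ 1) (hθ : -(Module.finrank ℝ E : ℝ) < γ - θ) (hg : Continuous g)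
    (hgc : HasCompactSupport g) :
    ∃ C, 0 ≤ C ∧ ∀ x₁ x₂, ‖(K ⋆[L, μ] g) x₁ - (K ⋆[L, μ] g) x₂‖ ≤
      C * (normPotential μ (γ - θ) g x₁ + normPotential μ (γ - θ) g x₂) * ‖x₁ - x₂‖ ^ θ := by
  obtain ⟨C, hC0, hC⟩ := hK.exists_norm_sub_le hγ hθ0 hθ1
  have hloc := hK.locallyIntegrable (μ := μ) (by linarith)
  refine ⟨‖L‖ * C, by positivity, fun x₁ x₂ => ?_⟩
  have hi := fun x => (hgc.convolutionExists_right L hloc hg x).integrable_swap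
  rw [convolution_eq_swap, convolution_eq_swap, ← integral_sub (hi x₁) (hi x₂)]
  have h := norm_integral_le_normPotential (μ := μ) L hθ hg hgc
    (A := fun y => K (x₁ - y) - K (x₂ - y)) (c := C * ‖x₁ - x₂‖ ^ θ) (x₁ := x₁) (x₂ := x₂)
    (fun y h₁ h₂ => by
      have := hC (x₂ - y) (sub_ne_zero.mpr h₂.symm) (x₁ - y) (sub_ne_zero.mpr h₁.symm)
      rwa [sub_sub_sub_cancel_right, add_comm] at this)
  simp only [map_sub, sub_apply] at h
  exact h.trans_eq (by ring)

lemma hasFDerivAt_convolution [CompleteSpace H] (hK : IsSingularKernel K γ) (hγ : γ ≤ 1)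
    (hγ' : -(Module.finrank ℝ E : ℝ) < γ - 1) (hg : Continuous g)
    (hgc : HasCompactSupport g) (x : E) :
    HasFDerivAt (K ⋆[L, μ] g) ((fderiv ℝ K ⋆[L.precompL E, μ] g) x) x := by
  obtain ⟨θ, hθ1, hθ⟩ := exists_between
    (show (1 : ℝ) < min 2 (γ + Module.finrank ℝ E) from lt_min (by norm_num) (by linarith))
  obtain ⟨hθ2, hθ3⟩ := lt_min_iff.mp hθ
  have hδ : -(Module.finrank ℝ E : ℝ) < γ - θ := by linarith
  obtain ⟨C, hC0, hC⟩ := hK.exists_norm_sub_sub_le (by linarith) hθ1.le hθ2.le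
  have hi := fun x => (hgc.convolutionExists_right L
    (hK.locallyIntegrable (μ := μ) (by linarith)) hg x).integrable_swap
  have hi' := (hgc.convolutionExists_right (L.precompL E)
    (hK.fderiv.locallyIntegrable (μ := μ) hγ') hg x).integrable_swap
  have hbound : ∀ x', ‖(K ⋆[L, μ] g) x' - (K ⋆[L, μ] g) x -
      (fderiv ℝ K ⋆[L.precompL E, μ] g) x (x' - x)‖ ≤
      ‖L‖ * C * (normPotential μ (γ - θ) g x + normPotential μ (γ - θ) g x') *
        ‖x' - x‖ ^ θ := fun x' => by
    have hsub : Integrable (fun y => L (K (x' - y)) (g y) - L (K (x - y)) (g y)) μ :=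
      (hi x').sub (hi x)
    rw [convolution_eq_swap, convolution_eq_swap, convolution_eq_swap,
      ContinuousLinearMap.integral_apply hi', ← integral_sub (hi x') (hi x),
      ← integral_sub hsub (hi'.apply_continuousLinearMap _)]
    have h := norm_integral_le_normPotential (μ := μ) L hδ hg hgc
      (A := fun y => K (x' - y) - K (x - y) - fderiv ℝ K (x - y) (x' - x))
      (c := C * ‖x' - x‖ ^ θ) (x₁ := x) (x₂ := x')
      (fun y h₁ h₂ => by
        have := hC (x - y) (sub_ne_zero.mpr h₁.symm) (x' - y) (sub_ne_zero.mpr h₂.symm)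
        rwa [sub_sub_sub_cancel_right] at this)
    simp only [map_sub, sub_apply] at h
    simp only [ContinuousLinearMap.precompL_apply, map_sub]
    exact h.trans_eq (by ring)
  rw [hasFDerivAt_iff_isLittleO]
  have hO : (fun x' => (K ⋆[L, μ] g) x' - (K ⋆[L, μ] g) x -
      (fderiv ℝ K ⋆[L.precompL E, μ] g) x (x' - x)) =O[nhds x] fun x' =>
      (‖L‖ * C * (normPotential μ (γ - θ) g x + normPotential μ (γ - θ) g x')) *
        ‖x' - x‖ ^ θ :=
    IsBigO.of_bound 1 (Eventually.of_forall fun x' => by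
      rw [one_mul]
      exact (hbound x').trans (le_abs_self _))
  have hcont : Continuous fun x' =>
      ‖L‖ * C * (normPotential μ (γ - θ) g x + normPotential μ (γ - θ) g x') :=
    continuous_const.mul (continuous_const.add (continuous_normPotential hδ hg hgc))
  have ho : (fun x' : E => ‖x' - x‖ ^ θ) =o[nhds x] fun x' => ‖x' - x‖ := by
    have h0 : Tendsto (fun x' : E => ‖x' - x‖ ^ (θ - 1)) (nhds x) (nhds 0) := by
      have : Continuous fun x' : E => ‖x' - x‖ ^ (θ - 1) :=
        (continuous_id.sub continuous_const).norm.rpow_const fun _ => Or.inr (by linarith)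
      simpa [Real.zero_rpow (by linarith : θ - 1 ≠ 0)] using this.tendsto x
    have := ((isLittleO_one_iff ℝ).mpr h0).mul_isBigO (isBigO_refl (fun x' => ‖x' - x‖) (nhds x))
    simp only [one_mul] at this
    refine this.congr_left fun x' => ?_
    rw [← Real.rpow_add_one' (norm_nonneg _) (by linarith), sub_add_cancel]
  refine (hO.trans_isLittleO ?_).trans_isBigO (isBigO_norm_left.mpr (isBigO_refl _ _))
  simpa only [one_mul] using (hcont.continuousAt.isBigO_one ℝ).mul_isLittleO ho

lemma isLocallyHolderAt_zero_convolution (hK : IsSingularKernel K γ) (hγ : γ ≤ 1) {θ : ℝ}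
    (hθ0 : 0 ≤ θ) (hθ1 : θ ≤ 1) (hθ : -(Module.finrank ℝ E : ℝ) < γ - θ) (hg : Continuous g)
    (hgc : HasCompactSupport g) (x : E) : IsLocallyHolderAt θ 0 (K ⋆[L, μ] g) x := by
  obtain ⟨C, hC0, hC⟩ := hK.exists_norm_convolution_sub_le (μ := μ) L hγ hθ0 hθ1 hθ hg hgc
  have hw := continuous_normPotential (μ := μ) hθ hg hgc
  set w := normPotential μ (γ - θ) g
  have hV : {y | w y < w x + 1} ∈ nhds x :=
    (isOpen_lt hw continuous_const).mem_nhds (by simp)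
  refine IsLocallyHolderAt.zero_of_continuousOn hV
    (hgc.continuous_convolution_right L (hK.locallyIntegrable (by linarith)) hg).continuousOn
    (M := C * ((w x + 1) + (w x + 1))) fun x₁ h₁ x₂ h₂ => (hC x₁ x₂).trans ?_
  have h₁' : w x₁ < w x + 1 := h₁
  have h₂' : w x₂ < w x + 1 := h₂
  gcongr

end IsSingularKernel

section FarPart

variable [NormedSpace ℝ G]

namespace IsSingularKernel

variable {K : E → F} {γ ρ : ℝ} {g : E → G} {x₀ : E} (L : F →L[ℝ] G →L[ℝ] H)

lemma exists_norm_le_one_add_norm_rpow {E : Type*} [NormedAddCommGroup E] [NormedSpace ℝ E]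
    {K : E → F} (hK : IsSingularKernel K γ) (hγ : γ ≤ ρ) (hρ : ρ ≤ 0) (x₀ : E) :
    ∃ C, 0 ≤ C ∧ ∀ x ∈ ball x₀ 1, ∀ y ∉ ball x₀ 2, ‖K (x - y)‖ ≤ C * (1 + ‖y‖) ^ ρ := by
  obtain ⟨C, hC0, hC⟩ := hK.exists_norm_le
  have hB : 0 < 3 + ‖x₀‖ := by positivity
  refine ⟨C * ((3 + ‖x₀‖) ^ ρ)⁻¹, by positivity, fun x hx y hy => ?_⟩
  rw [mem_ball_iff_norm] at hx hy
  have h1 : 1 ≤ ‖x - y‖ := by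
    have := norm_sub_le_norm_sub_add_norm_sub y x x₀
    rw [norm_sub_rev y x] at this
    linarith
  have h2 : 1 + ‖y‖ ≤ (3 + ‖x₀‖) * ‖x - y‖ := by
    have a1 := norm_sub_norm_le y x
    have a2 := norm_sub_norm_le x x₀
    rw [norm_sub_rev y x] at a1
    nlinarith [norm_nonneg x₀]
  have hne : x - y ≠ 0 := norm_pos_iff.mp (by linarith)
  calc ‖K (x - y)‖ ≤ C * ‖x - y‖ ^ γ := hC _ hne
    _ ≤ C * ((1 + ‖y‖) / (3 + ‖x₀‖)) ^ ρ := by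
      gcongr C * ?_
      refine (Real.rpow_le_rpow_of_exponent_le h1 hγ).trans
        (Real.rpow_le_rpow_of_nonpos (by positivity) ?_ hρ)
      rwa [div_le_iff₀' hB]
    _ = _ := by
      rw [Real.div_rpow (by positivity) hB.le]
      ring

lemma exists_norm_apply_le {E : Type*} [NormedAddCommGroup E] [NormedSpace ℝ E]
    {K : E → F} {g : E → G} {x₀ : E} (hK : IsSingularKernel K γ) (hγ : γ ≤ ρ) (hρ : ρ ≤ 0)
    (hg0 : ∀ y ∈ ball x₀ 2, g y = 0) :
    ∃ C, ∀ x ∈ ball x₀ 1, ∀ y, ‖L (K (x - y)) (g y)‖ ≤ C * ((1 + ‖y‖) ^ ρ * ‖g y‖) := by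
  obtain ⟨C, hC0, hC⟩ := hK.exists_norm_le_one_add_norm_rpow hγ hρ x₀
  refine ⟨‖L‖ * C, fun x hx y => ?_⟩
  by_cases hy : y ∈ ball x₀ 2
  · simp [hg0 y hy]
  · calc ‖L (K (x - y)) (g y)‖ ≤ ‖L‖ * ‖K (x - y)‖ * ‖g y‖ := L.le_opNorm₂ _ _
      _ ≤ ‖L‖ * (C * (1 + ‖y‖) ^ ρ) * ‖g y‖ := by gcongr; exact hC x hx y hy
      _ = _ := by ring

variable [Nontrivial E]

lemma aestronglyMeasurable_apply (hK : IsSingularKernel K γ) (hg : Continuous g) (x : E) :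
    AEStronglyMeasurable (fun y => L (K (x - y)) (g y)) μ :=
  L.aestronglyMeasurable_comp₂ ((hK.aestronglyMeasurable (μ := μ)).comp_quasiMeasurePreserving
    (quasiMeasurePreserving_sub_left μ x)) hg.aestronglyMeasurable

lemma integrable_apply_of_far (hK : IsSingularKernel K γ) (hγ : γ ≤ ρ) (hρ : ρ ≤ 0)
    (hg : Continuous g) (hg0 : ∀ y ∈ ball x₀ 2, g y = 0)
    (hgi : Integrable (fun y => (1 + ‖y‖) ^ ρ * ‖g y‖) μ) {x : E} (hx : x ∈ ball x₀ 1) :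
    Integrable (fun y => L (K (x - y)) (g y)) μ := by
  obtain ⟨C, hC⟩ := hK.exists_norm_apply_le L hγ hρ hg0
  exact (hgi.const_mul C).mono' (hK.aestronglyMeasurable_apply L hg x)
    (Eventually.of_forall fun y => hC x hx y)

lemma hasFDerivAt_integral_of_far (hK : IsSingularKernel K γ) (hγ : γ ≤ ρ) (hρ : ρ ≤ 0)
    (hg : Continuous g) (hg0 : ∀ y ∈ ball x₀ 2, g y = 0)
    (hgi : Integrable (fun y => (1 + ‖y‖) ^ ρ * ‖g y‖) μ) {x : E} (hx : x ∈ ball x₀ 1) :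
    HasFDerivAt (fun x => ∫ y, L (K (x - y)) (g y) ∂μ)
      (∫ y, L.precompL E (fderiv ℝ K (x - y)) (g y) ∂μ) x := by
  obtain ⟨C, hC⟩ := hK.fderiv.exists_norm_apply_le (L.precompL E) (by linarith) hρ hg0
  refine hasFDerivAt_integral_of_dominated_of_fderiv_le
    (F' := fun x y => L.precompL E (fderiv ℝ K (x - y)) (g y)) (isOpen_ball.mem_nhds hx)
    (Eventually.of_forall fun x' => hK.aestronglyMeasurable_apply L hg x')
    (hK.integrable_apply_of_far L hγ hρ hg hg0 hgi hx)
    (hK.fderiv.aestronglyMeasurable_apply (L.precompL E) hg x)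
    (Eventually.of_forall fun y x' hx' => hC x' hx' y) (hgi.const_mul C)
    (Eventually.of_forall fun y x' hx' => ?_)
  by_cases hy : y ∈ ball x₀ 2
  · simp only [hg0 y hy, map_zero]
    exact hasFDerivAt_const _ _
  · have hne : x' - y ≠ 0 := sub_ne_zero.mpr fun h =>
      hy (h ▸ ball_subset_ball (by norm_num) hx')
    have h1 : HasFDerivAt (fun x => K (x - y)) (fderiv ℝ K (x' - y)) x' := by
      simpa [Function.comp_def] using
        (hK.differentiableAt hne).hasFDerivAt.comp x' ((hasFDerivAt_id x').sub_const y)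
    exact ((L.flip (g y)).hasFDerivAt.comp x' h1)

end IsSingularKernel

end FarPart

end Convolution

lemma integrable_one_add_norm_rpow_mul {E G : Type*} [NormedAddCommGroup E] [NormedSpace ℝ E]
    [FiniteDimensional ℝ E] [MeasurableSpace E] [BorelSpace E] {μ : Measure E}
    [μ.IsAddHaarMeasure] [NormedAddCommGroup G] {g : E → G} {a ρ : ℝ} (hg : Continuous g)
    (ha : 0 ≤ a) (hdecay : g =O[cocompact E] fun y => ‖y‖ ^ (-a))
    (haρ : (Module.finrank ℝ E : ℝ) < a - ρ) :
    Integrable (fun y => (1 + ‖y‖) ^ ρ * ‖g y‖) μ := by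
  have h0 (y : E) : 0 < 1 + ‖y‖ := by positivity
  have hc : Continuous fun y : E => (1 + ‖y‖) ^ ρ * ‖g y‖ :=
    ((by fun_prop : Continuous fun y : E => 1 + ‖y‖).rpow_const
      fun y => .inl (h0 y).ne').mul hg.norm
  have h1 : (fun y : E => ‖y‖ ^ (-a)) =O[cocompact E] fun y => (1 + ‖y‖) ^ (-a) := by
    refine .of_bound (2 ^ a) ?_
    filter_upwards [(tendsto_norm_cocompact_atTop (E := E)).eventually_ge_atTop 1] with y hy
    rw [Real.norm_of_nonneg (by positivity), Real.norm_of_nonneg (by positivity),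
      Real.rpow_neg (by positivity), Real.rpow_neg (by positivity), ← div_eq_mul_inv,
      ← Real.div_rpow (by positivity) (by positivity),
      ← Real.inv_rpow (by positivity)]
    gcongr
    rw [inv_le_iff_one_le_mul₀ (by linarith), div_mul_eq_mul_div, le_div_iff₀ (h0 y)]
    linarith
  have h2 : (fun y : E => (1 + ‖y‖) ^ ρ * ‖g y‖) =O[cocompact E]
      fun y => (1 + ‖y‖) ^ (-(a - ρ)) := by
    refine ((isBigO_refl _ _).mul (hdecay.norm_left.trans h1)).congr_right fun y => ?_
    rw [← Real.rpow_add (h0 y)]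
    congr 1
    ring
  exact hc.locallyIntegrable.integrable_of_isBigO_cocompact h2
    ((integrable_one_add_norm haρ).integrableAtFilter _)

section HigherDerivatives

open scoped Convolution

universe u

variable {E F G H : Type u} [NormedAddCommGroup E] [NormedSpace ℝ E] [FiniteDimensional ℝ E]
  [Nontrivial E] [MeasurableSpace E] [BorelSpace E] {μ : Measure E} [μ.IsAddHaarMeasure]
  [NormedAddCommGroup F] [NormedSpace ℝ F] [NormedAddCommGroup G] [NormedSpace ℝ G]
  [NormedAddCommGroup H] [NormedSpace ℝ H]

namespace IsSingularKernel

variable {K : E → F} {γ ρ ε : ℝ} {g : E → G} {x₀ : E} (L : F →L[ℝ] G →L[ℝ] H)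

lemma contDiffAt_integral_of_far (hK : IsSingularKernel K γ) (hγ : γ ≤ ρ) (hρ : ρ ≤ 0)
    (hg : Continuous g) (hg0 : ∀ y ∈ ball x₀ 2, g y = 0)
    (hgi : Integrable (fun y => (1 + ‖y‖) ^ ρ * ‖g y‖) μ) (j : ℕ) {x : E}
    (hx : x ∈ ball x₀ 1) :
    ContDiffAt ℝ j (fun x => ∫ y, L (K (x - y)) (g y) ∂μ) x := by
  induction j generalizing F H K γ with
  | zero =>
    exact contDiffAt_zero.mpr ⟨_, isOpen_ball.mem_nhds hx, fun y hy =>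
      (hK.hasFDerivAt_integral_of_far L hγ hρ hg hg0 hgi hy).continuousAt.continuousWithinAt⟩
  | succ j ih =>
    push_cast
    exact contDiffAt_succ_iff_hasFDerivAt.mpr ⟨_, ⟨_, isOpen_ball.mem_nhds hx, fun y hy =>
      hK.hasFDerivAt_integral_of_far L hγ hρ hg hg0 hgi hy⟩,
      ih (L.precompL E) hK.fderiv (by linarith)⟩

/-- Derivatives that fall on the kernel. -/
lemma isLocallyHolderAt_convolution_left [CompleteSpace H] (hK : IsSingularKernel K γ)
    (hγ : γ ≤ 1) (hε0 : 0 ≤ ε) (hε1 : ε < 1) (j : ℕ)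
    (hj : 1 - (Module.finrank ℝ E : ℝ) ≤ γ - j) (hg : Continuous g) (hgc : HasCompactSupport g)
    (x : E) : IsLocallyHolderAt ε j (K ⋆[L, μ] g) x := by
  induction j generalizing F H K γ with
  | zero =>
    rw [Nat.cast_zero] at hj
    exact hK.isLocallyHolderAt_zero_convolution L hγ hε0 hε1.le (by linarith) hg hgc x
  | succ j ih =>
    push_cast at hj
    have hj0 : (0 : ℝ) ≤ j := j.cast_nonneg
    exact .succ_of_hasFDerivAt (Eventually.of_forall fun y =>
      hK.hasFDerivAt_convolution L hγ (by linarith) hg hgc y)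
      (ih (L.precompL E) hK.fderiv (by linarith) (by linarith))

/-- `l` derivatives fall on the density, the other `j` on the kernel. -/
lemma isLocallyHolderAt_convolution [CompleteSpace H] (hK : IsSingularKernel K γ)
    (hγ : γ ≤ 1) (hε0 : 0 ≤ ε) (hε1 : ε < 1) (j : ℕ)
    (hj : 1 - (Module.finrank ℝ E : ℝ) ≤ γ - j) (l : ℕ) (hg : ContDiff ℝ l g)
    (hgc : HasCompactSupport g) (x : E) : IsLocallyHolderAt ε (j + l) (K ⋆[L, μ] g) x := by
  induction l generalizing G H with
  | zero => exact hK.isLocallyHolderAt_convolution_left L hγ hε0 hε1 j hj hg.continuous hgc x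
  | succ l ih =>
    have hj0 : (0 : ℝ) ≤ j := j.cast_nonneg
    exact .succ_of_hasFDerivAt (Eventually.of_forall fun y =>
      hgc.hasFDerivAt_convolution_right L (hK.locallyIntegrable (by linarith))
        (hg.of_le (by norm_cast; omega)) y)
      (ih (L.precompR E) (hg.fderiv_right (by norm_cast)) (hgc.fderiv ℝ))

lemma isLocallyHolderAt_integral [CompleteSpace H] {a : ℝ}
    (hK : IsSingularKernel K γ) (hγ : γ ≤ 0) (hε0 : 0 ≤ ε) (hε1 : ε < 1) (j : ℕ)
    (hj : 1 - (Module.finrank ℝ E : ℝ) ≤ γ - j) (l : ℕ) (hg : ContDiff ℝ l g) (ha : 0 ≤ a)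
    (hdecay : g =O[cocompact E] fun y => ‖y‖ ^ (-a))
    (haγ : (Module.finrank ℝ E : ℝ) < a - γ) (x : E) :
    IsLocallyHolderAt ε (j + l) (fun x => ∫ y, L (K (x - y)) (g y) ∂μ) x := by
  have hj0 : (0 : ℝ) ≤ j := j.cast_nonneg
  let φ : ContDiffBump x := ⟨2, 3, by norm_num, by norm_num⟩
  set g₁ : E → G := fun y => φ y • g y
  set g₂ : E → G := fun y => (1 - φ y) • g y
  have hg₁ : ContDiff ℝ l g₁ := φ.contDiff.smul hg
  have hg₁c : HasCompactSupport g₁ := φ.hasCompactSupport.smul_right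
  have hg₂ : Continuous g₂ := (continuous_const.sub φ.continuous).smul hg.continuous
  have hg₂0 : ∀ y ∈ ball x 2, g₂ y = 0 := fun y hy => by
    simp [g₂, φ.one_of_mem_closedBall (ball_subset_closedBall hy)]
  have hg₂d : g₂ =O[cocompact E] fun y => ‖y‖ ^ (-a) := by
    refine .trans (.of_bound 1 (Eventually.of_forall fun y => ?_)) hdecay
    rw [norm_smul, Real.norm_of_nonneg (sub_nonneg.mpr φ.le_one)]
    gcongr
    linarith [φ.nonneg (x := y)]
  have hg₂i := integrable_one_add_norm_rpow_mul (μ := μ) hg₂ ha hg₂d haγ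
  have hnear := hK.isLocallyHolderAt_convolution (μ := μ) L (by linarith) hε0 hε1 j hj l hg₁ hg₁c x
  have hfar := hK.contDiffAt_integral_of_far L le_rfl hγ hg₂ hg₂0 hg₂i (j + l + 1)
    (mem_ball_self one_pos)
  refine (hnear.add (.of_contDiffAt hε1.le hfar)).congr ?_
  filter_upwards [ball_mem_nhds x one_pos] with z hz
  have hi : Integrable (fun y => L (K (z - y)) (g₁ y)) μ :=
    (hg₁c.convolutionExists_right L (hK.locallyIntegrable (by linarith)) hg₁.continuous
      z).integrable_swap
  rw [Pi.add_apply, convolution_eq_swap,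
    ← integral_add hi (hK.integrable_apply_of_far L le_rfl hγ hg₂ hg₂0 hg₂i hz)]
  congr with y
  rw [← map_add, ← add_smul, add_sub_cancel, one_smul]
end IsSingularKernel

end HigherDerivatives

theorem stmt_17 (a : ℝ) (ha : 0 < a) (l : ℕ) (n : ℕ) (hn : 0 < n)
    (f : EuclideanSpace ℝ (Fin n) → ℂ) (hf : ContDiff ℝ l f)
    (hdecay : f =O[cocompact (EuclideanSpace ℝ (Fin n))] fun y => ‖y‖ ^ (-a))
    (α : ℂ) (hα0 : 1 ≤ α.re) (hα1 : α.re < min a n) :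
    ∀ ε : ℝ, 0 < ε → ε < 1 →
      ∀ x : EuclideanSpace ℝ (Fin n),
        ∃ V : Set (EuclideanSpace ℝ (Fin n)), IsOpen V ∧ x ∈ V ∧
          ContDiffOn ℝ (l + ⌊α.re⌋.toNat - 1) (riesz n f α) V ∧
          ∃ M : ℝ, ∀ x₁ ∈ V, ∀ x₂ ∈ V,
            ‖iteratedFDerivWithin ℝ (l + ⌊α.re⌋.toNat - 1) (riesz n f α) V x₁ -
              iteratedFDerivWithin ℝ (l + ⌊α.re⌋.toNat - 1) (riesz n f α) V x₂‖ ≤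
                M * ‖x₁ - x₂‖ ^ ε := by
  intro ε hε0 hε1 x
  obtain ⟨j, hj⟩ : ∃ j, ⌊α.re⌋.toNat = j + 1 :=
    Nat.exists_eq_succ_of_ne_zero (by have := Int.floor_pos.mpr hα0; omega)
  have hjα : (j : ℝ) + 1 ≤ α.re := by
    have h : ((j + 1 : ℕ) : ℤ) ≤ ⌊α.re⌋ := by omega
    exact_mod_cast Int.le_floor.mp h
  obtain ⟨hαa, hαn⟩ := lt_min_iff.mp hα1
  have : Nonempty (Fin n) := ⟨⟨0, hn⟩⟩
  have hre : (α - n).re = α.re - n := by simp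
  have hK := isSingularKernel_norm_cpow (E := EuclideanSpace ℝ (Fin n)) (α - n)
  have hmain := hK.isLocallyHolderAt_integral (μ := volume) (ContinuousLinearMap.mul ℝ ℂ)
    (by linarith) hε0.le hε1 j (by rw [finrank_euclideanSpace_fin]; linarith) l
    (contDiff_const.mul hf) ha.le (hdecay.const_mul_left (Hfun n α)⁻¹)
    (by rw [finrank_euclideanSpace_fin]; linarith) x
  have hriesz : riesz n f α = fun x => ∫ y, ContinuousLinearMap.mul ℝ ℂ
      ((‖x - y‖ : ℂ) ^ (α - n)) ((Hfun n α)⁻¹ * f y) := by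
    ext x
    rw [riesz, ← integral_const_mul]
    congr with y
    rw [ContinuousLinearMap.mul_apply']
    ring
  have hcast : ((l : WithTop ℕ∞) + (j + 1 : ℕ) - 1) = (j + l : ℕ) := by
    rw [show (l : WithTop ℕ∞) + (j + 1 : ℕ) = (j + l + 1 : ℕ) by push_cast; ring]
    rfl
  rw [← hriesz] at hmain
  rw [hj, hcast, show l + (j + 1) - 1 = j + l by omega]
  exact hmain.exists_isOpen
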